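/- Let $\ell$ be a positive integer and let $a_1, \ldots, a_\ell$ be positive real numbers. Consider the set $S = \{([m a_1], \ldots, [m a_\ell]) : m \in \mathbb{N}, m \geq 1\}$ in the torus $(\mathbb{R}/\mathbb{Z})^\ell$, where $[x]$ denotes the class of the real number $x$ in $\mathbb{R}/\mathbb{Z}$. Then there exists a connected additive subgroup $T$ of $(\mathbb{R}/\mathbb{Z})^\ell$ such that $T \cap S$ is dense in $T$ (with respect to the subspace topology on $T$). -/

import Mathlib

open MeasureTheory Filter Topology UnitAddTorus

theorem UnitAddTorus.mFourier_add_apply {d : Type*} [Fintype d] (n : d → ℤ) (x y : UnitAddTorus d) :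
    mFourier n (x + y) = mFourier n x * mFourier n y := by
  simp [mFourier, fourier_apply, smul_add, AddCircle.toCircle_add, Finset.prod_mul_distrib]

theorem UnitAddTorus.mFourier_zero_apply {d : Type*} [Fintype d] (n : d → ℤ) :
    mFourier n (0 : UnitAddTorus d) = 1 := by
  simp [mFourier, fourier_apply]

theorem UnitAddTorus.mFourier_nsmul_apply {d : Type*} [Fintype d] (n : d → ℤ) (m : ℕ)
    (x : UnitAddTorus d) : mFourier n (m • x) = mFourier n x ^ m := by
  induction m with
  | zero => simp [mFourier_zero_apply]
  | succ k ih => rw [succ_nsmul, mFourier_add_apply, ih, pow_succ]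

theorem UnitAddTorus.mFourier_apply_eq_toCircle {d : Type*} [Fintype d] (n : d → ℤ)
    (x : UnitAddTorus d) : mFourier n x = AddCircle.toCircle (∑ i, n i • x i) := by
  classical
  have h (s : Finset d) :
      ∏ i ∈ s, fourier (n i) (x i) = AddCircle.toCircle (∑ i ∈ s, n i • x i) := by
    induction s using Finset.induction_on with
    | empty => simp
    | insert a s ha ih =>
      rw [Finset.prod_insert ha, ih, Finset.sum_insert ha, AddCircle.toCircle_add, fourier_apply,
        Circle.coe_mul]
  exact h _

theorem UnitAddTorus.mFourier_apply_eq_one_iff {d : Type*} [Fintype d] (n : d → ℤ)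
    (x : UnitAddTorus d) : mFourier n x = 1 ↔ ∑ i, n i • x i = 0 := by
  rw [mFourier_apply_eq_toCircle, Circle.coe_eq_one, ← AddCircle.toCircle_zero (T := (1 : ℝ)),
    (AddCircle.injective_toCircle one_ne_zero).eq_iff]

theorem tendsto_average_pow_succ_of_ne_one {w : ℂ} (hw : ‖w‖ ≤ 1) (hw1 : w ≠ 1) :
    Tendsto (fun M : ℕ => (M : ℂ)⁻¹ * ∑ m ∈ Finset.range M, w ^ (m + 1)) atTop (𝓝 0) := by
  have hpos : 0 < ‖w - 1‖ := norm_pos_iff.2 (sub_ne_zero.2 hw1)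
  refine squeeze_zero_norm (a := fun M : ℕ => (M : ℝ)⁻¹ * (2 / ‖w - 1‖)) (fun M => ?_) ?_
  · rw [norm_mul, norm_inv, Complex.norm_natCast]
    gcongr
    simp_rw [pow_succ]
    rw [← Finset.sum_mul, geom_sum_eq hw1, norm_mul, norm_div]
    have : ‖w ^ M - 1‖ ≤ 2 := by
      refine (norm_sub_le _ _).trans ?_
      rw [norm_pow, norm_one]
      have := pow_le_one₀ (n := M) (norm_nonneg w) hw
      linarith
    calc ‖w ^ M - 1‖ / ‖w - 1‖ * ‖w‖ ≤ ‖w ^ M - 1‖ / ‖w - 1‖ * 1 := by gcongr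
      _ ≤ 2 / ‖w - 1‖ := by rw [mul_one]; gcongr
  · simpa using (tendsto_inv_atTop_nhds_zero_nat (𝕜 := ℝ)).mul_const (2 / ‖w - 1‖)

instance UnitAddCircle.isProbabilityMeasure_volume :
    IsProbabilityMeasure (volume : Measure UnitAddCircle) :=
  ⟨UnitAddCircle.measure_univ⟩

theorem UnitAddTorus.integral_mFourier_eq_zero {d : Type*} [Fintype d] (n : d → ℤ)
    (z : UnitAddTorus d) (h : mFourier n z ≠ 1) : ∫ x, mFourier n x = 0 := by
  have h1 : ∫ x, mFourier n (z + x) = ∫ x, mFourier n x := integral_add_left_eq_self _ z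
  simp_rw [mFourier_add_apply] at h1
  rw [integral_const_mul] at h1
  by_contra h0
  exact h (by simpa [h0] using h1)

/-- Weyl equidistribution: the averages of a continuous function along the multiples of a point
with independent coordinates converge to its integral. -/
theorem UnitAddTorus.tendsto_average_nsmul {d : Type*} [Fintype d] (z : UnitAddTorus d)
    (hz : ∀ n : d → ℤ, ∑ i, n i • z i = 0 → n = 0) (f : C(UnitAddTorus d, ℂ)) :
    Tendsto (fun M : ℕ => (M : ℂ)⁻¹ * ∑ m ∈ Finset.range M, f ((m + 1) • z)) atTop
      (𝓝 (∫ x, f x)) := by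
  set F : ℕ → C(UnitAddTorus d, ℂ) → ℂ :=
    fun M f => (M : ℂ)⁻¹ * ∑ m ∈ Finset.range M, f ((m + 1) • z) with hF
  have hint (f : C(UnitAddTorus d, ℂ)) : Integrable f :=
    f.continuous.integrable_of_hasCompactSupport (HasCompactSupport.of_compactSpace f)
  have hF_lip (M : ℕ) : LipschitzWith 1 (F M) := by
    refine LipschitzWith.of_dist_le_mul fun f g => ?_
    rw [dist_eq_norm, dist_eq_norm, NNReal.coe_one, one_mul]
    simp only [hF]
    rw [← mul_sub, ← Finset.sum_sub_distrib, norm_mul, norm_inv, Complex.norm_natCast]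
    calc (M : ℝ)⁻¹ * ‖∑ m ∈ Finset.range M, (f ((m + 1) • z) - g ((m + 1) • z))‖
        ≤ (M : ℝ)⁻¹ * (M * ‖f - g‖) := by
          gcongr
          refine (norm_sum_le_of_le (f := fun m => f ((m + 1) • z) - g ((m + 1) • z)) _
            fun m _ => (f - g).norm_coe_le_norm ((m + 1) • z)).trans ?_
          simp
      _ ≤ ‖f - g‖ := by
          rw [← mul_assoc]
          exact mul_le_of_le_one_left (norm_nonneg _) inv_mul_le_one
  have hI_lip : LipschitzWith 1 (fun f : C(UnitAddTorus d, ℂ) => ∫ x, f x) := by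
    refine LipschitzWith.of_dist_le_mul fun f g => ?_
    rw [dist_eq_norm, dist_eq_norm, NNReal.coe_one, one_mul, ← integral_sub (hint f) (hint g)]
    simpa using norm_integral_le_of_norm_le_const (μ := (volume : Measure (UnitAddTorus d)))
      (f := fun x => f x - g x) (.of_forall fun x => (f - g).norm_coe_le_norm x)
  have hclosed : IsClosed {f | Tendsto (F · f) atTop (𝓝 (∫ x, f x))} :=
    (LipschitzWith.uniformEquicontinuous F 1 hF_lip).equicontinuous.isClosed_setOfPred_tendsto
      hI_lip.continuous
  have hspan : (Submodule.span ℂ (Set.range (mFourier (d := d))) : Set C(UnitAddTorus d, ℂ)) ⊆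
      {f | Tendsto (F · f) atTop (𝓝 (∫ x, f x))} := by
    intro f hf
    induction hf using Submodule.span_induction with
    | mem f hf =>
      obtain ⟨n, rfl⟩ := hf
      by_cases hn : n = 0
      · subst hn
        simp only [Set.mem_ofPred_eq, hF, mFourier_zero, ContinuousMap.one_apply, integral_const,
          Finset.sum_const, Finset.card_range, nsmul_eq_mul, mul_one, probReal_univ, one_smul]
        refine tendsto_const_nhds.congr' ?_
        filter_upwards [eventually_ne_atTop 0] with M hM
        exact (inv_mul_cancel₀ (Nat.cast_ne_zero.2 hM)).symm
      · have h1 : mFourier n z ≠ 1 := fun h => hn (hz n ((mFourier_apply_eq_one_iff n z).1 h))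
        simp only [Set.mem_ofPred_eq, hF, integral_mFourier_eq_zero n z h1, mFourier_nsmul_apply]
        exact tendsto_average_pow_succ_of_ne_one
          (((mFourier n).norm_coe_le_norm z).trans mFourier_norm.le) h1
    | zero => simp [hF]
    | add f g _ _ hf hg =>
      simp only [Set.mem_ofPred_eq, hF, ContinuousMap.add_apply, Finset.sum_add_distrib, mul_add,
        integral_add (hint f) (hint g)] at hf hg ⊢
      exact hf.add hg
    | smul c f _ hf =>
      simp only [Set.mem_ofPred_eq, hF, ContinuousMap.smul_apply, smul_eq_mul, ← Finset.mul_sum,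
        integral_const_mul, mul_left_comm _ c] at hf ⊢
      exact hf.const_mul c
  have hmem : f ∈ (Submodule.span ℂ (Set.range (mFourier (d := d)))).topologicalClosure := by
    rw [span_mFourier_closure_eq_top]; trivial
  exact closure_minimal hspan hclosed hmem

/-- Kronecker approximation: the positive multiples of a point of the torus with independent
coordinates are dense. -/
theorem UnitAddTorus.dense_nsmul {d : Type*} [Fintype d] (z : UnitAddTorus d)
    (hz : ∀ n : d → ℤ, ∑ i, n i • z i = 0 → n = 0) :
    Dense {x : UnitAddTorus d | ∃ m : ℕ, 1 ≤ m ∧ x = m • z} := by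
  intro x
  by_contra hx
  obtain ⟨f, hf0, hf1, hf⟩ := exists_continuous_zero_one_of_isClosed isClosed_closure
    (isClosed_singleton (x := x)) (Set.disjoint_singleton_right.2 hx)
  have hpos : 0 < ∫ y, f y :=
    f.continuous.integral_pos_of_hasCompactSupport_nonneg_nonzero
      (HasCompactSupport.of_compactSpace f) (fun y => (hf y).1) (x := x)
      (by rw [hf1 rfl]; exact one_ne_zero)
  have key := tendsto_average_nsmul z hz ⟨fun y => (f y : ℂ), by fun_prop⟩
  have hzero (m : ℕ) : f ((m + 1) • z) = 0 := hf0 (subset_closure ⟨m + 1, by omega, rfl⟩)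
  simp only [ContinuousMap.coe_mk, hzero, Complex.ofReal_zero, Finset.sum_const_zero, mul_zero,
    integral_complex_ofReal, tendsto_const_nhds_iff] at key
  exact hpos.ne (by exact_mod_cast key)


/-- Up to a common positive factor, finitely many reals are integral combinations of `1` and of
finitely many reals whose classes in `ℝ / ℤ` are independent over `ℤ`. -/
theorem exists_intCast_combination_of_finite {ι : Type*} [Finite ι] (a : ι → ℝ) :
    ∃ (s : Finset ℝ) (N : ℕ) (p : ι → ℤ) (q : ι → s → ℤ), 0 < N ∧
      (∀ i, (N : ℝ) * a i = p i + ∑ j, (q i j : ℝ) * j) ∧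
      ∀ k : s → ℤ, ∑ j, k j • ((j : ℝ) : UnitAddCircle) = 0 → k = 0 := by
  classical
  have h1 : LinearIndepOn ℚ id ({1} : Set ℝ) := by simp
  obtain ⟨b, hbt, h1b, hspan, hb⟩ := exists_linearIndepOn_extension h1
    (Set.singleton_subset_iff.2 (Set.mem_insert 1 (Set.range a)))
  rw [Set.image_id, Set.image_id] at hspan
  have hbfin : b.Finite := ((Set.finite_range a).insert 1).subset hbt
  obtain ⟨s, hs⟩ := (hbfin.sdiff (t := {1})).exists_finset_coe
  have hbs : b = insert 1 (s : Set ℝ) := by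
    rw [hs, Set.insert_sdiff_singleton, Set.insert_eq_of_mem (h1b rfl)]
  have h1s : (1 : ℝ) ∉ (s : Set ℝ) := by simp [hs]
  rw [hbs, linearIndepOn_id_insert h1s] at hb
  obtain ⟨hli, hnot⟩ := hb
  have hcoef (i : ι) : ∃ (c : ℚ) (e : s → ℚ), a i = c + ∑ j, (e j : ℝ) * j := by
    have hi := hspan (Set.mem_insert_of_mem 1 ⟨i, rfl⟩)
    rw [SetLike.mem_coe, hbs, Submodule.mem_span_insert] at hi
    obtain ⟨c, y, hy, hcy⟩ := hi
    rw [← Subtype.range_coe (s := (s : Set ℝ)), Submodule.mem_span_range_iff_exists_fun] at hy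
    obtain ⟨e, rfl⟩ := hy
    exact ⟨c, e, by simpa [Rat.smul_def] using hcy⟩
  choose c e hce using hcoef
  obtain ⟨⟨D, hD⟩, hint⟩ := IsLocalization.exist_integer_multiples_of_finite (nonZeroDivisors ℤ)
    (Sum.elim c (fun x : ι × s => e x.1 x.2))
  have hD0 : D ≠ 0 := nonZeroDivisors.ne_zero hD
  choose g hg using hint
  have hgR (x) : (g x : ℝ) = D * (Sum.elim c (fun x : ι × s => e x.1 x.2) x : ℚ) := by
    have := hg x
    simp only [algebraMap_int_eq, eq_intCast, zsmul_eq_mul] at this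
    exact_mod_cast this
  refine ⟨s, D.natAbs, fun i => D.sign * g (.inl i), fun i j => D.sign * g (.inr (i, j)),
    Int.natAbs_pos.2 hD0, fun i => ?_, fun k hk => ?_⟩
  · have hDs : ((D.natAbs : ℕ) : ℝ) = D.sign * D := by
      rw [← Int.cast_mul, Int.sign_mul_self_eq_natAbs, Int.cast_natCast]
    push_cast
    rw [hDs]
    simp only [hgR, Sum.elim_inl, Sum.elim_inr]
    rw [hce i, mul_add, Finset.mul_sum, mul_assoc]
    congr 1
    exact Finset.sum_congr rfl fun j _ => by ring
  · have hk' : ((∑ j, (k j : ℝ) * (j : ℝ) : ℝ) : UnitAddCircle) = 0 := by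
      rw [← hk, ← QuotientAddGroup.mk'_apply, map_sum]
      refine Finset.sum_congr rfl fun j _ => ?_
      rw [← zsmul_eq_mul, map_zsmul, QuotientAddGroup.mk'_apply]
    obtain ⟨r, hr⟩ := (AddCircle.coe_eq_zero_iff 1).1 hk'
    rw [zsmul_one] at hr
    have hsum : ∑ j, (k j : ℚ) • (j : ℝ) = r := by rw [hr]; simp [Rat.smul_def]
    have hr0 : r = 0 := by
      by_contra hr0
      refine hnot ?_
      have hmem : ((r : ℚ)⁻¹) • ∑ j : s, (k j : ℚ) • (j : ℝ) ∈ Submodule.span ℚ (s : Set ℝ) :=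
        Submodule.smul_mem _ _ (Submodule.sum_mem _ fun j _ =>
          Submodule.smul_mem _ _ (Submodule.subset_span j.2))
      rw [hsum, Rat.smul_def] at hmem
      push_cast at hmem
      rwa [inv_mul_cancel₀ (Int.cast_ne_zero.2 hr0)] at hmem
    rw [hr0, Int.cast_zero] at hsum
    have := Fintype.linearIndependent_iff.1 hli (fun j => (k j : ℚ)) hsum
    exact funext fun j => by exact_mod_cast this j

/-- Lemma 4.7: there is a connected subgroup `T` of the torus `(ℝ/ℤ)^ℓ` such that
the intersection of `T` with `{([m a₁], …, [m a_ℓ]) : m ≥ 1}` is dense in `T`. -/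
theorem exists_connected_subgroup_dense_orbit
    (ℓ : ℕ) (hℓ : 0 < ℓ) (a : Fin ℓ → ℝ) (ha : ∀ i, 0 < a i) :
    ∃ T : AddSubgroup (Fin ℓ → AddCircle (1 : ℝ)),
      IsConnected (T : Set (Fin ℓ → AddCircle (1 : ℝ))) ∧
      (T : Set (Fin ℓ → AddCircle (1 : ℝ))) ⊆
        closure ((T : Set (Fin ℓ → AddCircle (1 : ℝ))) ∩
          {x | ∃ m : ℕ, 1 ≤ m ∧ x = fun i => (((m : ℝ) * a i : ℝ) : AddCircle (1 : ℝ))}) := by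
  obtain ⟨s, N, p, q, hN, hNa, hind⟩ := exists_intCast_combination_of_finite a
  let φ : UnitAddTorus s →+ (Fin ℓ → AddCircle (1 : ℝ)) :=
    { toFun := fun t i => ∑ j, q i j • t j
      map_zero' := by ext i; simp
      map_add' := fun t u => by ext i; simp [smul_add, Finset.sum_add_distrib] }
  have hφ : Continuous φ :=
    continuous_pi fun i => continuous_finsetSum _ fun j _ => (continuous_apply j).zsmul _
  let z : UnitAddTorus s := fun j => ((j : ℝ) : UnitAddCircle)
  have hφz (m : ℕ) : φ (m • z) = fun i => ((((m * N : ℕ) : ℝ) * a i : ℝ) : AddCircle (1 : ℝ)) := by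
    rw [map_nsmul]
    ext i
    have hcast : ((((N : ℝ) * a i : ℝ)) : AddCircle (1 : ℝ)) = φ z i := by
      have hp : ((p i : ℝ) : AddCircle (1 : ℝ)) = 0 :=
        (AddCircle.coe_eq_zero_iff 1).2 ⟨p i, by simp⟩
      rw [hNa i, AddCircle.coe_add, hp, zero_add, ← QuotientAddGroup.mk'_apply, map_sum]
      refine Finset.sum_congr rfl fun j _ => ?_
      rw [← zsmul_eq_mul, map_zsmul, QuotientAddGroup.mk'_apply]
    rw [Pi.smul_apply, ← hcast, ← AddCircle.coe_nsmul, nsmul_eq_mul, Nat.cast_mul, mul_assoc]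
  refine ⟨φ.range, ?_, ?_⟩
  · rw [AddMonoidHom.coe_range]
    exact isConnected_range hφ
  · rw [AddMonoidHom.coe_range, ← Set.image_univ, ← (UnitAddTorus.dense_nsmul z hind).closure_eq]
    refine (image_closure_subset_closure_image hφ).trans (closure_mono ?_)
    rintro _ ⟨_, ⟨m, hm, rfl⟩, rfl⟩
    exact ⟨⟨m • z, subset_closure ⟨m, hm, rfl⟩, rfl⟩, m * N, Nat.mul_pos hm hN, hφz m⟩
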